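/- Let {X(t)}_{t∈ℝ} be a centered Gaussian process whose trajectories are, with probability 1, continuous nowhere differentiable functions on ℝ. Let J ⊂ ℝ be a non-degenerate compact interval and define the deterministic quantity b_X(J) = sup{ b ≥ 0 : sup_{t',t''∈J, t'≠t''} E|X(t')−X(t'')|² / |t'−t''|^{2b} < ∞ }. Then P{ β_X(J) = b_X(J) } = 1, where β_X(J,ω) is the uniform Hölder exponent over J of the trajectory t ↦ X(t,ω). -/

import Mathlib

open MeasureTheory ProbabilityTheory Filter Set Topology

noncomputable section

/-- A centered Gaussian process: every finite real-linear combination of its values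
has a centered Gaussian distribution. -/
def IsCenteredGaussianProcess {Ω : Type*} [MeasurableSpace Ω] {T : Type*}
    (X : T → Ω → ℝ) (P : Measure Ω) : Prop :=
  ∀ (n : ℕ) (t : Fin n → T) (c : Fin n → ℝ), ∃ v : NNReal,
    Measure.map (fun ω => ∑ i, c i * X (t i) ω) P = gaussianReal 0 v

/-- The uniform Hölder exponent of `f` over `J`:
`β_f(J) = sup{β ≥ 0 : sup_{t'≠t''∈J} |f(t')−f(t'')|/|t'−t''|^β < ∞}`. -/
def uniformHolderExp (f : ℝ → ℝ) (J : Set ℝ) : ℝ :=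
  sSup {β : ℝ | 0 ≤ β ∧ ∃ C : ℝ, ∀ t' ∈ J, ∀ t'' ∈ J, t' ≠ t'' →
    |f t' - f t''| / |t' - t''| ^ β ≤ C}

/-- The deterministic exponent
`b_X(J) = sup{b ≥ 0 : sup_{t'≠t''∈J} E|X(t')−X(t'')|²/|t'−t''|^{2b} < ∞}`. -/
def gaussSupExp {Ω : Type*} [MeasurableSpace Ω] (P : Measure Ω) (X : ℝ → Ω → ℝ)
    (J : Set ℝ) : ℝ :=
  sSup {b : ℝ | 0 ≤ b ∧ ∃ C : ℝ, ∀ t' ∈ J, ∀ t'' ∈ J, t' ≠ t'' →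
    (∫ ω, (X t' ω - X t'' ω) ^ 2 ∂P) / |t' - t''| ^ (2 * b) ≤ C}


def HolderSet (f : ℝ → ℝ) (J : Set ℝ) : Set ℝ :=
  {β : ℝ | 0 ≤ β ∧ ∃ C : ℝ, ∀ t' ∈ J, ∀ t'' ∈ J, t' ≠ t'' →
    |f t' - f t''| / |t' - t''| ^ β ≤ C}

lemma holderSet_down {f : ℝ → ℝ} {a b : ℝ} {β γ : ℝ} (hβ : β ∈ HolderSet f (Icc a b))
    (h0 : 0 ≤ γ) (hγ : γ ≤ β) : γ ∈ HolderSet f (Icc a b) := by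
  obtain ⟨hb, C, hC⟩ := hβ
  refine ⟨h0, |C| * |b - a| ^ (β - γ), fun s hs t ht hst => ?_⟩
  have hpos : 0 < |s - t| := abs_pos.mpr (sub_ne_zero.mpr hst)
  have h1 := hC s hs t ht hst
  have hd : |s - t| ≤ |b - a| := by
    have hab : a ≤ b := hs.1.trans hs.2
    rw [abs_of_nonneg (sub_nonneg.mpr hab), abs_le]
    constructor <;> linarith [hs.1, hs.2, ht.1, ht.2]
  have h2 : |f s - f t| / |s - t| ^ γ = |f s - f t| / |s - t| ^ β * |s - t| ^ (β - γ) := by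
    rw [Real.rpow_sub hpos]
    have := (Real.rpow_pos_of_pos hpos β).ne'
    field_simp
  rw [h2]
  exact mul_le_mul (h1.trans (le_abs_self C))
    (Real.rpow_le_rpow hpos.le hd (by linarith)) (by positivity) (abs_nonneg _)

lemma holderSet_le_one {f : ℝ → ℝ} {a b : ℝ} (hab : a < b)
    (hf : ∀ t : ℝ, ¬ DifferentiableAt ℝ f t) {β : ℝ} (hβ : β ∈ HolderSet f (Icc a b)) :
    β ≤ 1 := by
  by_contra! h1
  obtain ⟨hb, C, hC⟩ := hβ
  set c := (a + b) / 2 with hc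
  have hcm : c ∈ Icc a b := ⟨by linarith, by linarith⟩
  apply hf c
  have : HasDerivAt f 0 c := by
    rw [hasDerivAt_iff_tendsto]
    have hnb : Icc a b ∈ 𝓝 c := Icc_mem_nhds (by linarith) (by linarith)
    have hlim : Tendsto (fun x => |C| * |x - c| ^ (β - 1)) (𝓝 c) (𝓝 0) := by
      have h : ContinuousAt (fun x => |C| * |x - c| ^ (β - 1)) c := by
        refine continuousAt_const.mul (ContinuousAt.rpow_const (by fun_prop) (Or.inr (by linarith)))
      have h' := h.tendsto
      simpa [Real.zero_rpow (by linarith : β - 1 ≠ 0)] using h'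
    refine squeeze_zero' (Eventually.of_forall fun x => by positivity) ?_ hlim
    filter_upwards [hnb] with x hx
    by_cases hxc : x = c
    · subst hxc; simp; positivity
    have hpos : 0 < |x - c| := abs_pos.mpr (sub_ne_zero.mpr hxc)
    have := hC x hx c hcm hxc
    rw [div_le_iff₀ (by positivity)] at this
    simp only [smul_zero, sub_zero, Real.norm_eq_abs]
    rw [Real.rpow_sub hpos, Real.rpow_one, inv_mul_le_iff₀ hpos]
    have h2 : |x - c| * (|C| * (|x - c| ^ β / |x - c|)) = |C| * |x - c| ^ β := by field_simp
    rw [h2]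
    exact this.trans (mul_le_mul_of_nonneg_right (le_abs_self C) (by positivity))
  exact this.differentiableAt

/-- deterministic dyadic chaining on [0,1] -/
lemma dyadic_holder {g : ℝ → ℝ} (hg : Continuous g) {γ K : ℝ} (hγ : 0 < γ) (hK : 0 ≤ K)
    (h : ∀ n : ℕ, ∀ k : ℕ, k < 2 ^ n →
      |g (((k : ℝ) + 1) / 2 ^ n) - g ((k : ℝ) / 2 ^ n)| ≤ K * ((2 : ℝ) ^ (-γ)) ^ n) :
    ∃ C : ℝ, ∀ s ∈ Icc (0:ℝ) 1, ∀ t ∈ Icc (0:ℝ) 1, |g s - g t| ≤ C * |s - t| ^ γ := by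
  set r : ℝ := (2 : ℝ) ^ (-γ) with hr
  have hr0 : 0 < r := by positivity
  have hr1 : r < 1 := Real.rpow_lt_one_of_one_lt_of_neg (by norm_num) (by linarith)
  let π : ℕ → ℝ → ℝ := fun n t => (⌊(2:ℝ) ^ n * t⌋₊ : ℝ) / 2 ^ n
  have hπle : ∀ n t, 0 ≤ t → π n t ≤ t := by
    intro n t ht
    show _ / _ ≤ _
    rw [div_le_iff₀ (by positivity), mul_comm]
    exact Nat.floor_le (by positivity)
  have hπlt : ∀ n t, t < π n t + 1 / 2 ^ n := by
    intro n t
    show _ < _ / _ + _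
    rw [← add_div, lt_div_iff₀ (by positivity), mul_comm]
    exact Nat.lt_floor_add_one _
  have hfl : ∀ n t, t ≤ 1 → ⌊(2:ℝ) ^ n * t⌋₊ ≤ 2 ^ n := by
    intro n t ht
    have : (2:ℝ) ^ n * t ≤ ((2 ^ n : ℕ) : ℝ) := by
      push_cast
      exact mul_le_of_le_one_right (by positivity) ht
    exact Nat.floor_le_of_le this
  have hstep : ∀ n t, 0 ≤ t → t ≤ 1 → |g (π (n+1) t) - g (π n t)| ≤ K * r ^ (n+1) := by
    intro n t h0 h1
    set m := ⌊(2:ℝ) ^ n * t⌋₊ with hm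
    set m' := ⌊(2:ℝ) ^ (n+1) * t⌋₊ with hm'
    have e1 : π n t = ((2 * m : ℕ) : ℝ) / 2 ^ (n+1) := by
      show (m:ℝ) / _ = _
      push_cast; rw [pow_succ]; field_simp
    have e2 : π (n+1) t = (m' : ℝ) / 2 ^ (n+1) := rfl
    have i1 : 2 * m ≤ m' := by
      apply Nat.le_floor
      have := Nat.floor_le (show 0 ≤ (2:ℝ) ^ n * t by positivity)
      push_cast; rw [pow_succ]; rw [← hm] at this; linarith
    have i2 : m' < 2 * m + 2 := by
      rw [hm', Nat.floor_lt (by positivity)]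
      have := Nat.lt_floor_add_one ((2:ℝ) ^ n * t)
      push_cast; rw [pow_succ]; rw [← hm] at this; linarith
    have i3 : m' ≤ 2 ^ (n+1) := hfl (n+1) t h1
    rw [e1, e2]
    rcases (by omega : m' = 2 * m ∨ m' = 2 * m + 1) with h' | h'
    · rw [h']; simp; positivity
    · rw [h']
      have := h (n+1) (2*m) (by omega)
      push_cast at this ⊢
      exact this
  have hlim : ∀ t, 0 ≤ t → Tendsto (fun n => π n t) atTop (𝓝 t) := by
    intro t ht
    have h0 : Tendsto (fun n : ℕ => t - 1 / (2:ℝ) ^ n) atTop (𝓝 t) := by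
      have : Tendsto (fun n : ℕ => (1 / (2:ℝ)) ^ n) atTop (𝓝 0) :=
        tendsto_pow_atTop_nhds_zero_of_lt_one (by norm_num) (by norm_num)
      have := (tendsto_const_nhds (x := t)).sub this
      simpa using this
    exact tendsto_of_tendsto_of_tendsto_of_le_of_le h0 tendsto_const_nhds
      (fun n => by have := hπlt n t; simp only; linarith) (fun n => hπle n t ht)
  set K' := K / (1 - r) with hK'
  have hK'0 : 0 ≤ K' := div_nonneg hK (by linarith)
  have htail : ∀ n t, 0 ≤ t → t ≤ 1 → |g t - g (π n t)| ≤ K' * r ^ n := by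
    intro n t h0 h1
    have hpart : ∀ j, |g (π (n + j) t) - g (π n t)| ≤ K' * r ^ n * (1 - r ^ j) := by
      intro j
      induction j with
      | zero => simp
      | succ j ih =>
        have h3 := hstep (n + j) t h0 h1
        have h4 : |g (π (n + (j+1)) t) - g (π n t)| ≤
            |g (π (n + j + 1) t) - g (π (n + j) t)| + |g (π (n + j) t) - g (π n t)| :=
          abs_sub_le _ _ _
        have h5 : K * r ^ (n + j + 1) ≤ K' * r ^ n * (r ^ j - r ^ (j+1)) := by
          have : K = K' * (1 - r) := by rw [hK', div_mul_cancel₀ _ (by linarith)]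
          have h6 : K' * r ^ n * (r ^ j - r ^ (j+1)) = K * r ^ (n + j) := by
            rw [this]; ring
          rw [h6]
          exact mul_le_mul_of_nonneg_left
            (pow_le_pow_of_le_one hr0.le hr1.le (by omega)) hK
        calc _ ≤ _ := h4
          _ ≤ K' * r ^ n * (r ^ j - r ^ (j+1)) + K' * r ^ n * (1 - r ^ j) := by linarith
          _ = _ := by ring
    have hl : Tendsto (fun j => |g (π (n + j) t) - g (π n t)|) atTop (𝓝 |g t - g (π n t)|) := by
      have h7 : Tendsto (fun j => π (n + j) t) atTop (𝓝 t) :=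
        (hlim t h0).comp (tendsto_atTop_mono (fun j => Nat.le_add_left j n) tendsto_id)
      exact (((hg.tendsto t).comp h7).sub_const _).abs
    refine le_of_tendsto hl (Eventually.of_forall fun j => (hpart j).trans ?_)
    have : 0 ≤ r ^ j := by positivity
    have h8 : 0 ≤ K' * r ^ n := by positivity
    nlinarith
  have main : ∀ s ∈ Icc (0:ℝ) 1, ∀ t ∈ Icc (0:ℝ) 1, s < t →
      |g s - g t| ≤ ((2 * K' + K) / r) * |s - t| ^ γ := by
    intro s hs t ht hst
    have hd0 : 0 < t - s := by linarith
    have hd1 : t - s ≤ 1 := by linarith [hs.1, ht.2]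
    obtain ⟨n, hn1, hn2⟩ := exists_nat_pow_near_of_lt_one hd0 hd1 (by norm_num : (0:ℝ) < 1/2) (by norm_num)
    have hmid : |g (π n s) - g (π n t)| ≤ K * r ^ n := by
      set m := ⌊(2:ℝ) ^ n * s⌋₊ with hm
      set m' := ⌊(2:ℝ) ^ n * t⌋₊ with hm'
      have hp : (0:ℝ) < 2 ^ n := by positivity
      have i1 : m ≤ m' := Nat.floor_le_floor (by nlinarith)
      have i2 : m' < m + 2 := by
        rw [hm', Nat.floor_lt (mul_nonneg hp.le ht.1)]
        have h9 := Nat.lt_floor_add_one ((2:ℝ) ^ n * s)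
        have h10 : (2:ℝ) ^ n * (t - s) ≤ 1 := by
          calc _ ≤ (2:ℝ) ^ n * (1/2) ^ n := by gcongr
            _ = 1 := by rw [← mul_pow]; norm_num
        push_cast; rw [← hm] at h9; linarith
      have i3 : m' ≤ 2 ^ n := hfl n t ht.2
      show |g (m / 2 ^ n) - g (m' / 2 ^ n)| ≤ _
      rcases (by omega : m' = m ∨ m' = m + 1) with h' | h'
      · rw [h']; simp; positivity
      · rw [h', abs_sub_comm]
        have := h n m (by omega)
        push_cast
        exact this
    have a1 := htail n s hs.1 hs.2
    have a2 := htail n t ht.1 ht.2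
    have hrn : r ^ (n+1) ≤ |s - t| ^ γ := by
      rw [abs_sub_comm, abs_of_pos hd0]
      calc r ^ (n+1) = ((1/2 : ℝ) ^ (n+1)) ^ γ := by
            rw [hr, Real.rpow_neg (by norm_num), ← Real.inv_rpow (by norm_num),
              ← Real.rpow_natCast, ← Real.rpow_natCast, ← Real.rpow_mul (by norm_num),
              ← Real.rpow_mul (by norm_num), mul_comm]; norm_num
        _ ≤ _ := Real.rpow_le_rpow (by positivity) hn1.le hγ.le
    have b1 : |g s - g t| ≤ |g s - g (π n s)| + |g (π n s) - g (π n t)| + |g t - g (π n t)| := by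
      rw [abs_sub_comm (g t)]
      have e : g s - g t = (g s - g (π n s)) + (g (π n s) - g (π n t)) + (g (π n t) - g t) := by ring
      rw [e]
      exact abs_add_three _ _ _
    calc |g s - g t| ≤ (2 * K' + K) * r ^ n := by linarith
      _ = ((2 * K' + K) / r) * r ^ (n+1) := by rw [pow_succ]; field_simp
      _ ≤ _ := by gcongr
  refine ⟨(2 * K' + K) / r, fun s hs t ht => ?_⟩
  rcases lt_trichotomy s t with h' | h' | h'
  · exact main s hs t ht h'
  · rw [h']; simp; positivity
  · rw [abs_sub_comm (g s), abs_sub_comm s]; exact main t ht s hs h'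

lemma incr_law {Ω : Type*} [MeasurableSpace Ω] {P : Measure Ω} [IsProbabilityMeasure P]
    {X : ℝ → Ω → ℝ} (hG : IsCenteredGaussianProcess X P) (s t : ℝ) :
    AEMeasurable (fun ω => X s ω - X t ω) P ∧
    ∃ v : NNReal, Measure.map (fun ω => X s ω - X t ω) P = gaussianReal 0 v := by
  obtain ⟨v, hv⟩ := hG 2 ![s, t] ![1, -1]
  have e : (fun ω => ∑ i, (![1, -1] : Fin 2 → ℝ) i * X ((![s, t] : Fin 2 → ℝ) i) ω)
      = fun ω => X s ω - X t ω := by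
    funext ω; simp [Fin.sum_univ_two]; ring
  rw [e] at hv
  refine ⟨?_, v, hv⟩
  by_contra hn
  rw [Measure.map_of_not_aemeasurable hn] at hv
  exact (IsProbabilityMeasure.ne_zero (gaussianReal 0 v)) hv.symm

lemma second_moment {Ω : Type*} [MeasurableSpace Ω] {P : Measure Ω} [IsProbabilityMeasure P]
    {Z : Ω → ℝ} (hm : AEMeasurable Z P) {v : NNReal} (hv : P.map Z = gaussianReal 0 v) :
    ∫ ω, Z ω ^ 2 ∂P = v := by
  have h1 : ∫ x, x ^ 2 ∂(P.map Z) = ∫ ω, Z ω ^ 2 ∂P :=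
    integral_map hm (by fun_prop)
  rw [← h1, hv]
  have h2 := variance_fun_id_gaussianReal (μ := 0) (v := v)
  rw [variance_eq_integral (by fun_prop)] at h2
  simpa using h2

lemma even_moment {Ω : Type*} [MeasurableSpace Ω] {P : Measure Ω} [IsProbabilityMeasure P]
    {Z : Ω → ℝ} (hm : AEMeasurable Z P) {v : NNReal} (hv : P.map Z = gaussianReal 0 v) (m : ℕ) :
    ∫⁻ ω, ENNReal.ofReal (Z ω ^ (2 * m)) ∂P =
      ENNReal.ofReal ((v : ℝ) ^ m * ∫ x, x ^ (2 * m) ∂(gaussianReal 0 1)) := by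
  have h1 : ∫⁻ x, ENNReal.ofReal (x ^ (2 * m)) ∂(P.map Z)
      = ∫⁻ ω, ENNReal.ofReal (Z ω ^ (2 * m)) ∂P :=
    lintegral_map' (by fun_prop) hm
  have h2 : (gaussianReal 0 1).map (fun x => (√(v:ℝ)) * x) = gaussianReal 0 v := by
    rw [gaussianReal_map_const_mul]
    congr 1
    · simp
    · ext; simp
  have hInt : Integrable (fun x : ℝ => x ^ (2 * m)) (gaussianReal 0 1) := by
    have := (memLp_id_gaussianReal (μ := 0) (v := 1) ((2 * m : ℕ) : NNReal)).integrable_norm_pow'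
    refine this.congr (Eventually.of_forall fun x => ?_)
    simp [pow_mul]
  rw [← h1, hv, ← h2, lintegral_map (by fun_prop) (by fun_prop), ← integral_const_mul,
    ofReal_integral_eq_lintegral_ofReal (hInt.const_mul _)]
  · refine lintegral_congr fun x => ?_
    rw [mul_pow, pow_mul (√(v:ℝ)), Real.sq_sqrt (NNReal.coe_nonneg v)]
  · refine Eventually.of_forall fun x => ?_
    show 0 ≤ (v:ℝ) ^ m * x ^ (2 * m)
    rw [pow_mul]; positivity

lemma anti_conc {v : NNReal} (hv : v ≠ 0) (c : ℝ) :
    gaussianReal 0 v (Icc (-c) c) ≤ ENNReal.ofReal (2 * c / √(v:ℝ)) := by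
  rw [gaussianReal_apply 0 hv]
  have hv0 : (0:ℝ) < v := by positivity
  have hle : ∀ x, gaussianPDF 0 v x ≤ ENNReal.ofReal (1 / √(v:ℝ)) := by
    intro x
    apply ENNReal.ofReal_le_ofReal
    rw [gaussianPDFReal_def]
    have h1 : Real.exp (-(x - 0) ^ 2 / (2 * (v:ℝ))) ≤ 1 := by
      rw [Real.exp_le_one_iff, neg_div]
      have : 0 ≤ (x - 0) ^ 2 / (2 * (v:ℝ)) := by positivity
      linarith
    have h2 : √(v:ℝ) ≤ √(2 * Real.pi * v) := by
      apply Real.sqrt_le_sqrt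
      nlinarith [Real.pi_gt_three]
    have h3 : (√(2 * Real.pi * v))⁻¹ ≤ 1 / √(v:ℝ) := by
      rw [one_div]; exact inv_anti₀ (by positivity) h2
    calc _ ≤ (√(2 * Real.pi * v))⁻¹ * 1 := by
            exact mul_le_mul_of_nonneg_left h1 (by positivity)
      _ ≤ _ := by linarith
  calc ∫⁻ x in Icc (-c) c, gaussianPDF 0 v x
      ≤ ∫⁻ x in Icc (-c) c, ENNReal.ofReal (1 / √(v:ℝ)) := lintegral_mono fun x => hle x
    _ = ENNReal.ofReal (1 / √(v:ℝ)) * ENNReal.ofReal (c - -c) := by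
        rw [setLIntegral_const, Real.volume_Icc]
    _ = _ := by
        rw [← ENNReal.ofReal_mul (by positivity)]; congr 1; ring

def GaussSet {Ω : Type*} [MeasurableSpace Ω] (P : Measure Ω) (X : ℝ → Ω → ℝ)
    (J : Set ℝ) : Set ℝ :=
  {b : ℝ | 0 ≤ b ∧ ∃ C : ℝ, ∀ t' ∈ J, ∀ t'' ∈ J, t' ≠ t'' →
    (∫ ω, (X t' ω - X t'' ω) ^ 2 ∂P) / |t' - t''| ^ (2 * b) ≤ C}

lemma upper_part {Ω : Type*} [MeasurableSpace Ω] {P : Measure Ω} [IsProbabilityMeasure P]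
    {X : ℝ → Ω → ℝ} (hG : IsCenteredGaussianProcess X P) {J : Set ℝ} {γ : ℝ} (h0 : 0 ≤ γ)
    (hγ : γ ∉ GaussSet P X J) : ∀ᵐ ω ∂P, γ ∉ HolderSet (fun t => X t ω) J := by
  let S : ℕ → Set Ω := fun N => {ω | ∀ s ∈ J, ∀ t ∈ J, s ≠ t →
    |X s ω - X t ω| / |s - t| ^ γ ≤ N}
  have hS : ∀ N, P (S N) = 0 := by
    intro N
    by_contra hne
    apply hγ
    set δ := (P (S N)).toReal with hδ
    have hδ0 : 0 < δ := ENNReal.toReal_pos hne (measure_ne_top _ _)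
    refine ⟨h0, 4 * (N:ℝ) ^ 2 / δ ^ 2, fun s hs t ht hst => ?_⟩
    obtain ⟨hm, v, hv⟩ := incr_law hG s t
    rw [second_moment hm hv]
    have hpos : 0 < |s - t| := abs_pos.mpr (sub_ne_zero.mpr hst)
    by_cases hv0 : v = 0
    · rw [hv0]; simp; positivity
    have hv1 : (0:ℝ) < v := by positivity
    set h := |s - t| ^ γ with hh
    have hhp : 0 < h := by positivity
    have hsub : S N ⊆ (fun ω => X s ω - X t ω) ⁻¹' Icc (-(N * h)) (N * h) := by
      intro ω hω
      have := hω s hs t ht hst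
      rw [div_le_iff₀ hhp] at this
      exact abs_le.mp this
    have h1 : P (S N) ≤ ENNReal.ofReal (2 * (N * h) / √(v:ℝ)) := by
      calc _ ≤ _ := measure_mono hsub
        _ = P.map (fun ω => X s ω - X t ω) (Icc (-(N * h)) (N * h)) :=
          (Measure.map_apply_of_aemeasurable hm measurableSet_Icc).symm
        _ ≤ _ := by rw [hv]; exact anti_conc hv0 _
    have h2 : δ ≤ 2 * (N * h) / √(v:ℝ) := ENNReal.toReal_le_of_le_ofReal (by positivity) h1
    rw [le_div_iff₀ (by positivity)] at h2
    have h3 : δ ^ 2 * v ≤ 4 * (N:ℝ) ^ 2 * h ^ 2 := by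
      calc δ ^ 2 * v = (δ * √(v:ℝ)) ^ 2 := by rw [mul_pow, Real.sq_sqrt hv1.le]
        _ ≤ (2 * (N * h)) ^ 2 := by gcongr
        _ = _ := by ring
    have h4 : |s - t| ^ (2 * γ) = h ^ 2 := by
      rw [hh, ← Real.rpow_natCast, ← Real.rpow_mul hpos.le]; congr 1; push_cast; ring
    rw [h4, div_le_div_iff₀ (by positivity) (by positivity)]
    linarith
  have hU : P (⋃ N, S N) = 0 := measure_iUnion_null hS
  refine measure_mono_null (fun ω hω => ?_) hU
  have hω' : γ ∈ HolderSet (fun t => X t ω) J := by simpa using hω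
  obtain ⟨-, C, hC⟩ := hω'
  obtain ⟨N, hN⟩ := exists_nat_ge C
  exact mem_iUnion.mpr ⟨N, fun s hs t ht hst => (hC s hs t ht hst).trans hN⟩

lemma lower_part {Ω : Type*} [MeasurableSpace Ω] {P : Measure Ω} [IsProbabilityMeasure P]
    {X : ℝ → Ω → ℝ} (hG : IsCenteredGaussianProcess X P)
    (hc : ∀ᵐ ω ∂P, Continuous (fun t => X t ω)) {a b : ℝ} (hab : a < b) {β γ : ℝ} (h0 : 0 < γ)
    (hγβ : γ < β) (hβ : β ∈ GaussSet P X (Icc a b)) :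
    ∀ᵐ ω ∂P, γ ∈ HolderSet (fun t => X t ω) (Icc a b) := by
  obtain ⟨hβ0, C, hC⟩ := hβ
  set L := b - a with hL
  have hL0 : 0 < L := by linarith
  obtain ⟨m, hm⟩ := exists_nat_gt (1 / (2 * (β - γ)))
  have hm1 : 1 < 2 * (m:ℝ) * (β - γ) := by
    rw [div_lt_iff₀ (by linarith)] at hm; linarith
  have hm0 : m ≠ 0 := by rintro rfl; norm_num at hm1
  let p : ℕ → ℕ → ℝ := fun n k => a + L * ((k:ℝ) / 2 ^ n)
  let D : ℕ → ℕ → Ω → ℝ := fun n k ω => X (p n (k+1)) ω - X (p n k) ω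
  set M := ∫ x, x ^ (2 * m) ∂(gaussianReal 0 1) with hM
  have hM0 : 0 ≤ M := integral_nonneg fun x => by
    show 0 ≤ x ^ (2 * m)
    rw [pow_mul]; positivity
  set q : ℝ := (2:ℝ) ^ (-(2 * (m:ℝ) * (β - γ))) with hq
  have hq0 : 0 < q := by positivity
  have h2q : 2 * q < 1 := by
    have : 2 * q = (2:ℝ) ^ (1 - 2 * (m:ℝ) * (β - γ)) := by
      rw [hq, sub_eq_add_neg 1, Real.rpow_add (by norm_num), Real.rpow_one]
    rw [this]
    exact Real.rpow_lt_one_of_one_lt_of_neg (by norm_num) (by linarith)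
  set A : ℝ := (|C| * L ^ (2 * β)) ^ m * M with hA
  have hA0 : 0 ≤ A := by positivity
  let G : ℕ → ℕ → Ω → ENNReal := fun n k ω =>
    ENNReal.ofReal ((((2:ℝ) ^ γ) ^ n) ^ (2 * m)) * ENNReal.ofReal (D n k ω ^ (2 * m))
  have hDm : ∀ n k, AEMeasurable (D n k) P := fun n k => (incr_law hG _ _).1
  have hGm : ∀ n k, AEMeasurable (G n k) P := fun n k =>
    (((hDm n k).pow_const _).ennreal_ofReal).const_mul _
  have hGb : ∀ n k, k < 2 ^ n → ∫⁻ ω, G n k ω ∂P ≤ ENNReal.ofReal (A * q ^ n) := by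
    intro n k hk
    have hk' : ((k:ℝ) + 1) ≤ 2 ^ n := by exact_mod_cast hk
    have hp2 : (0:ℝ) < 2 ^ n := by positivity
    have hmem1 : p n k ∈ Icc a b := by
      have : (k:ℝ) / 2 ^ n ≤ 1 := by rw [div_le_one hp2]; linarith
      have h' : 0 ≤ (k:ℝ) / 2 ^ n := by positivity
      constructor <;> simp only [p] <;> nlinarith
    have hmem2 : p n (k+1) ∈ Icc a b := by
      have : ((k + 1 : ℕ):ℝ) / 2 ^ n ≤ 1 := by rw [div_le_one hp2]; push_cast; linarith
      have h' : 0 ≤ ((k + 1 : ℕ):ℝ) / 2 ^ n := by positivity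
      constructor <;> simp only [p] <;> nlinarith
    have hdiff : p n (k+1) - p n k = L / 2 ^ n := by
      simp only [p]; push_cast; field_simp; ring
    have hdpos : 0 < L / 2 ^ n := by positivity
    have hne : p n (k+1) ≠ p n k := by
      intro h; rw [h, sub_self] at hdiff; linarith
    obtain ⟨hmeas, v, hv⟩ := incr_law hG (p n (k+1)) (p n k)
    have h1 := hC _ hmem2 _ hmem1 hne
    rw [second_moment hmeas hv, hdiff, abs_of_pos hdpos, div_le_iff₀ (by positivity)] at h1
    have h2 : (v:ℝ) ≤ |C| * L ^ (2 * β) * ((2:ℝ) ^ (-(2 * β))) ^ n := by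
      calc (v:ℝ) ≤ |C| * (L / 2 ^ n) ^ (2 * β) :=
            h1.trans (mul_le_mul_of_nonneg_right (le_abs_self C) (by positivity))
        _ = _ := by
          rw [Real.div_rpow hL0.le hp2.le, mul_assoc, div_eq_mul_inv, ← Real.rpow_neg hp2.le,
            ← Real.rpow_natCast, ← Real.rpow_natCast, ← Real.rpow_mul (by norm_num),
            ← Real.rpow_mul (by norm_num)]
          ring_nf
    have h3 : ∫⁻ ω, G n k ω ∂P =
        ENNReal.ofReal ((((2:ℝ) ^ γ) ^ n) ^ (2 * m)) * ENNReal.ofReal ((v:ℝ) ^ m * M) := by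
      rw [lintegral_const_mul' _ _ ENNReal.ofReal_ne_top]
      congr 1
      exact even_moment hmeas hv m
    rw [h3, ← ENNReal.ofReal_mul (by positivity)]
    apply ENNReal.ofReal_le_ofReal
    have h4 : q ^ n = (((2:ℝ) ^ γ) ^ n) ^ (2 * m) * (((2:ℝ) ^ (-(2 * β))) ^ n) ^ m := by
      rw [hq]
      simp only [← Real.rpow_natCast]
      simp only [← Real.rpow_mul (show (0:ℝ) ≤ 2 by norm_num)]
      rw [← Real.rpow_add (by norm_num)]
      congr 1
      push_cast; ring
    calc _ ≤ (((2:ℝ) ^ γ) ^ n) ^ (2 * m) *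
          ((|C| * L ^ (2 * β) * ((2:ℝ) ^ (-(2 * β))) ^ n) ^ m * M) := by gcongr
      _ = A * q ^ n := by rw [h4, hA, mul_pow (|C| * L ^ (2 * β))]; ring
  let F : Ω → ENNReal := fun ω => ∑' n, ∑ k ∈ Finset.range (2 ^ n), G n k ω
  have hFm : ∀ n, AEMeasurable (fun ω => ∑ k ∈ Finset.range (2 ^ n), G n k ω) P := fun n =>
    Finset.aemeasurable_fun_sum _ fun k _ => hGm n k
  have hF : ∫⁻ ω, F ω ∂P ≠ ⊤ := by
    have : ∫⁻ ω, F ω ∂P ≤ ENNReal.ofReal (∑' n : ℕ, A * (2 * q) ^ n) := by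
      have hsum : Summable fun n : ℕ => A * (2 * q) ^ n :=
        (summable_geometric_of_lt_one (by positivity) h2q).mul_left A
      rw [ENNReal.ofReal_tsum_of_nonneg (fun n => by positivity) hsum]
      simp only [F]
      rw [lintegral_tsum hFm]
      refine ENNReal.tsum_le_tsum fun n => ?_
      rw [lintegral_finsetSum' _ fun k _ => hGm n k]
      calc _ ≤ ∑ k ∈ Finset.range (2 ^ n), ENNReal.ofReal (A * q ^ n) :=
            Finset.sum_le_sum fun k hk => hGb n k (Finset.mem_range.mp hk)
        _ = ENNReal.ofReal (∑ k ∈ Finset.range (2 ^ n), A * q ^ n) :=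
            (ENNReal.ofReal_sum_of_nonneg fun _ _ => by positivity).symm
        _ = _ := by
            congr 1
            rw [Finset.sum_const, Finset.card_range, nsmul_eq_mul]; push_cast; ring
    exact ne_top_of_le_ne_top ENNReal.ofReal_ne_top this
  have hFae : ∀ᵐ ω ∂P, F ω < ⊤ := ae_lt_top' (AEMeasurable.tsum hFm) hF
  filter_upwards [hFae, hc] with ω hω hcω
  set T := (F ω).toReal with hT
  have hT0 : 0 ≤ T := ENNReal.toReal_nonneg
  have hbound : ∀ n k : ℕ, k < 2 ^ n → |D n k ω| ≤ (1 + T) * ((2:ℝ) ^ (-γ)) ^ n := by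
    intro n k hk
    have h1 : G n k ω ≤ F ω :=
      (Finset.single_le_sum (f := fun k => G n k ω) (fun _ _ => bot_le)
        (Finset.mem_range.mpr hk)).trans (ENNReal.le_tsum n)
    have h2 : ((((2:ℝ) ^ γ) ^ n) * |D n k ω|) ^ (2 * m) ≤ T := by
      have h3 : G n k ω = ENNReal.ofReal (((((2:ℝ) ^ γ) ^ n) * |D n k ω|) ^ (2 * m)) := by
        simp only [G]
        rw [← ENNReal.ofReal_mul (by positivity), mul_pow]
        congr 2
        rw [pow_mul, pow_mul |_|, sq_abs]
      rw [h3] at h1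
      exact (ENNReal.ofReal_le_iff_le_toReal hω.ne).mp h1
    have h4 : (((2:ℝ) ^ γ) ^ n) * |D n k ω| ≤ 1 + T := by
      by_contra! hlt
      have h5 : (1 + T) ^ 1 ≤ (1 + T) ^ (2 * m) := pow_le_pow_right₀ (by linarith) (by omega)
      have h6 : (1 + T) ^ (2 * m) ≤ ((((2:ℝ) ^ γ) ^ n) * |D n k ω|) ^ (2 * m) := by gcongr
      linarith
    rw [Real.rpow_neg (by norm_num), inv_pow, ← div_eq_mul_inv, le_div_iff₀ (by positivity)]
    linarith
  obtain ⟨C', hC'⟩ := dyadic_holder (g := fun u => X (a + L * u) ω)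
    (hcω.comp (by fun_prop)) h0 (by linarith : 0 ≤ 1 + T) (fun n k hk => by
      have := hbound n k hk
      simp only [D, p] at this
      push_cast at this
      exact this)
  refine ⟨h0.le, C' / L ^ γ, fun s hs t ht hst => ?_⟩
  have hpos : 0 < |s - t| := abs_pos.mpr (sub_ne_zero.mpr hst)
  have hmem : ∀ x ∈ Icc a b, (x - a) / L ∈ Icc (0:ℝ) 1 := fun x hx =>
    ⟨div_nonneg (by linarith [hx.1]) hL0.le, by rw [div_le_one hL0]; linarith [hx.2]⟩
  have h7 := hC' _ (hmem s hs) _ (hmem t ht)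
  have hback : ∀ x, a + L * ((x - a) / L) = x := fun x => by field_simp; ring
  have hd : |(s - a) / L - (t - a) / L| = |s - t| / L := by
    rw [← sub_div, abs_div, abs_of_pos hL0]; congr 2; ring
  simp only [hback] at h7
  rw [hd, Real.div_rpow hpos.le hL0.le] at h7
  rw [div_le_iff₀ (by positivity)]
  calc _ ≤ _ := h7
    _ = _ := by ring

/-- With probability 1, the uniform Hölder exponent over a non-degenerate compact
interval `J = [a,b]` of a trajectory of a centered Gaussian process with continuous
nowhere differentiable trajectories equals the deterministic quantity `b_X(J)`. -/
theorem uniform_holder_exponent_deterministic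
    {Ω : Type*} [MeasurableSpace Ω] (P : Measure Ω) [IsProbabilityMeasure P]
    (X : ℝ → Ω → ℝ)
    (hGauss : IsCenteredGaussianProcess X P)
    (hpath : ∀ᵐ ω ∂P, Continuous (fun t => X t ω) ∧
      ∀ t : ℝ, ¬ DifferentiableAt ℝ (fun u => X u ω) t)
    (a b : ℝ) (hab : a < b) :
    P {ω | uniformHolderExp (fun t => X t ω) (Set.Icc a b)
        = gaussSupExp P X (Set.Icc a b)} = 1 := by
  have hc : ∀ᵐ ω ∂P, Continuous (fun t => X t ω) := hpath.mono fun ω h => h.1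
  have hbdd : ∀ β ∈ GaussSet P X (Icc a b), β ≤ 1 := by
    intro β hβ
    by_contra! h1
    have h2 := lower_part hGauss hc hab (γ := (1 + β) / 2) (by linarith) (by linarith) hβ
    obtain ⟨ω, hω1, hω2⟩ := (h2.and hpath).exists
    have := holderSet_le_one hab hω2.2 hω1
    linarith
  have hB : BddAbove (GaussSet P X (Icc a b)) := ⟨1, fun β hβ => hbdd β hβ⟩
  set B := gaussSupExp P X (Icc a b) with hBdef
  have hBs : B = sSup (GaussSet P X (Icc a b)) := rfl
  have hB0 : 0 ≤ B := Real.sSup_nonneg fun x hx => hx.1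
  have hlow : ∀ᵐ ω ∂P, ∀ r : ℚ, 0 < (r:ℝ) → (r:ℝ) < B →
      (r:ℝ) ∈ HolderSet (fun t => X t ω) (Icc a b) := by
    rw [ae_all_iff]
    intro r
    by_cases hr : 0 < (r:ℝ) ∧ (r:ℝ) < B
    · have hne : (GaussSet P X (Icc a b)).Nonempty := by
        by_contra hne
        rw [Set.not_nonempty_iff_eq_empty] at hne
        rw [hne, Real.sSup_empty] at hBs
        linarith [hr.1, hr.2]
      obtain ⟨β, hβ, hlt⟩ := exists_lt_of_lt_csSup hne (hBs ▸ hr.2)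
      filter_upwards [lower_part hGauss hc hab hr.1 hlt hβ] with ω hω _ _ using hω
    · exact Eventually.of_forall fun ω h1 h2 => absurd ⟨h1, h2⟩ hr
  have hup : ∀ᵐ ω ∂P, ∀ r : ℚ, B < (r:ℝ) →
      (r:ℝ) ∉ HolderSet (fun t => X t ω) (Icc a b) := by
    rw [ae_all_iff]
    intro r
    by_cases hr : B < (r:ℝ)
    · have hn : (r:ℝ) ∉ GaussSet P X (Icc a b) := fun h => by
        have := le_csSup hB h
        rw [← hBs] at this
        linarith
      filter_upwards [upper_part hGauss (hB0.trans hr.le) hn] with ω hω _ using hω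
    · exact Eventually.of_forall fun ω h1 => absurd h1 hr
  have hfin : ∀ᵐ ω ∂P, uniformHolderExp (fun t => X t ω) (Icc a b) = B := by
    filter_upwards [hpath, hlow, hup] with ω h1 h2 h3
    have e : uniformHolderExp (fun t => X t ω) (Icc a b)
        = sSup (HolderSet (fun t => X t ω) (Icc a b)) := rfl
    rw [e]
    apply le_antisymm
    · refine Real.sSup_le (fun x hx => ?_) hB0
      by_contra! hlt
      obtain ⟨r, hr1, hr2⟩ := exists_rat_btwn hlt
      exact h3 r hr1 (holderSet_down hx (hB0.trans hr1.le) hr2.le)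
    · refine le_of_forall_rat_lt_imp_le fun r hr => ?_
      by_cases hr0 : 0 < (r:ℝ)
      · exact le_csSup ⟨1, fun x hx => holderSet_le_one hab h1.2 hx⟩ (h2 r hr0 hr)
      · exact (not_lt.mp hr0).trans (Real.sSup_nonneg fun x hx => hx.1)
  rw [measure_congr (show {ω | uniformHolderExp (fun t => X t ω) (Icc a b) = B} =ᵐ[P] univ from
    eventuallyEq_univ.mpr hfin), measure_univ]

end
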